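/- Let A be a unital C*-algebra, H a Hilbert space, and φ: A → B(H) a completely positive, completely contractive linear map. Let n ≥ 1, let α_1,…,α_n, β_1,…,β_n ∈ A, and let ε ≥ 0. If Σ_{k=1}^{n} φ(α_k α_k*) − Σ_{k=1}^{n} φ(α_k)φ(α_k)* ≤ ε·1 in B(H), then ‖Σ_{k=1}^{n} φ(α_k β_k*) − Σ_{k=1}^{n} φ(α_k)φ(β_k)*‖² ≤ 2ε·‖Σ_{k=1}^{n} β_k β_k*‖. -/

import Mathlib

/-!
**Statement 4.**  A matrix inequality for completely positive completely
contractive maps from a unital C*-algebra into `B(H)`.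
-/

noncomputable section

open scoped ComplexOrder InnerProductSpace

universe u v

/-- `φ : C → B(H)` is a completely positive and completely contractive linear
map.  Complete positivity is recorded through the standard characterization:
for all `n`, `a : Fin n → C` and `h : Fin n → H` one has
`0 ≤ ∑_{i,j} ⟪h i, φ((a i)* * a j)(h j)⟫` (every positive matrix over `C` is a
sum of Gram matrices `((a_i)* a_j)_{ij}`, and positivity of a matrix of
operators is tested against vectors, so this is exactly positivity of all
amplifications).  For completely positive maps the completely bounded norm
coincides with the norm, so complete contractivity is recorded as
contractivity. -/
structure IsCPCMap {C : Type u} [NonUnitalCStarAlgebra C] {H : Type v}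
    [NormedAddCommGroup H] [InnerProductSpace ℂ H] [CompleteSpace H]
    (φ : C → H →L[ℂ] H) : Prop where
  map_add : ∀ x y, φ (x + y) = φ x + φ y
  map_smul : ∀ (z : ℂ) x, φ (z • x) = z • φ x
  completely_positive : ∀ (n : ℕ) (a : Fin n → C) (h : Fin n → H),
    0 ≤ ∑ i, ∑ j, ⟪h i, φ (star (a i) * a j) (h j)⟫_ℂ
  contractive : ∀ x, ‖φ x‖ ≤ ‖x‖

namespace IsCPCMap

variable {A : Type u} [CStarAlgebra A] {H : Type v} [NormedAddCommGroup H]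
  [InnerProductSpace ℂ H] [CompleteSpace H] {φ : A → H →L[ℂ] H}

theorem map_star (hφ : IsCPCMap φ) (a : A) : φ (star a) = star (φ a) := by
  have him (g h : H) : (⟪h, φ a g⟫_ℂ + ⟪g, φ (star a) h⟫_ℂ).im = 0 := by
    have h1 := (Complex.le_def.1 (hφ.completely_positive 2 ![1, a] ![h, g])).2
    have h2 := (Complex.le_def.1 (hφ.completely_positive 1 ![1] ![h])).2
    have h3 := (Complex.le_def.1 (hφ.completely_positive 1 ![a] ![g])).2
    simp [Fin.sum_univ_two] at h1 h2 h3
    simp only [Complex.add_im]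
    linarith
  refine ContinuousLinearMap.ext fun h => ext_inner_left ℂ fun g => ?_
  rw [ContinuousLinearMap.star_eq_adjoint, ContinuousLinearMap.adjoint_inner_right,
    ← inner_conj_symm (φ a g) h]
  have h1 := him g h
  have h2 := him g (Complex.I • h)
  rw [(φ (star a)).map_smul, inner_smul_left, inner_smul_right] at h2
  simp at h1 h2
  apply Complex.ext <;> simp [-inner_conj_symm] <;> linarith

/-- A Cauchy–Schwarz type positivity: the operator matrix with entries
`φ (x * star y) - φ x * star (φ y)`, for `x` and `y` in `{a, b}`, is positive. -/
theorem schwarz_nonneg (hφ : IsCPCMap φ) (a b : A) (ξ η : H) :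
    0 ≤ (⟪ξ, (φ (a * star a) - φ a * star (φ a)) ξ⟫_ℂ).re
      + 2 * (⟪ξ, (φ (a * star b) - φ a * star (φ b)) η⟫_ℂ).re
      + (⟪η, (φ (b * star b) - φ b * star (φ b)) η⟫_ℂ).re := by
  have hone : ‖φ 1‖ ≤ 1 := by
    refine (hφ.contractive 1).trans ?_
    nontriviality A
    exact CStarRing.norm_one.le
  have hstar : star (φ 1) = φ 1 := by rw [← hφ.map_star, star_one]
  set ζ := star (φ a) ξ + star (φ b) η with hζ
  have hζ1 : (⟪ζ, φ 1 ζ⟫_ℂ).re ≤ ‖ζ‖ ^ 2 :=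
    calc (⟪ζ, φ 1 ζ⟫_ℂ).re ≤ ‖ζ‖ * ‖φ 1 ζ‖ := re_inner_le_norm (𝕜 := ℂ) _ _
      _ ≤ ‖ζ‖ * (1 * ‖ζ‖) := by gcongr; exact (φ 1).le_of_opNorm_le hone ζ
      _ = ‖ζ‖ ^ 2 := by ring
  have hpos := (Complex.le_def.1
    (hφ.completely_positive 3 ![star a, star b, 1] ![ξ, η, -ζ])).1
  have hba : (⟪η, φ (b * star a) ξ⟫_ℂ).re = (⟪ξ, φ (a * star b) η⟫_ℂ).re := by
    have : b * star a = star (a * star b) := by simp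
    rw [this, hφ.map_star, ContinuousLinearMap.star_eq_adjoint,
      ContinuousLinearMap.adjoint_inner_right]
    exact inner_re_symm (𝕜 := ℂ) _ _
  have hmove (c : A) (x y : H) : ⟪x, φ c y⟫_ℂ = ⟪star (φ c) x, y⟫_ℂ := by
    rw [ContinuousLinearMap.star_eq_adjoint, ContinuousLinearMap.adjoint_inner_left]
  have hζa : (⟪ξ, φ a ζ⟫_ℂ).re + (⟪η, φ b ζ⟫_ℂ).re = ‖ζ‖ ^ 2 := by
    rw [hmove, hmove, ← Complex.add_re, ← inner_add_left, ← hζ]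
    exact inner_self_eq_norm_sq (𝕜 := ℂ) ζ
  have hζb : (⟪ζ, star (φ a) ξ⟫_ℂ).re + (⟪ζ, star (φ b) η⟫_ℂ).re = ‖ζ‖ ^ 2 := by
    rw [← Complex.add_re, ← inner_add_right, ← hζ]
    exact inner_self_eq_norm_sq (𝕜 := ℂ) ζ
  have hexp : ‖ζ‖ ^ 2 = (⟪ξ, φ a (star (φ a) ξ)⟫_ℂ).re
      + 2 * (⟪ξ, φ a (star (φ b) η)⟫_ℂ).re + (⟪η, φ b (star (φ b) η)⟫_ℂ).re := by
    have := inner_re_symm (𝕜 := ℂ) (star (φ a) ξ) (star (φ b) η)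
    simp only [RCLike.re_to_complex] at this
    rw [← hζb, hζ]
    simp only [hmove, inner_add_left, Complex.add_re]
    linarith
  simp [Fin.sum_univ_three, hφ.map_star, hstar] at hpos
  simp only [sub_apply, mul_apply_eq_comp, inner_sub_right,
    Complex.sub_re]
  linarith

end IsCPCMap

/-- A bounded operator `S` is controlled by the diagonal of a positive `2 × 2` block form. -/
theorem opNorm_sq_le_of_forall_nonneg {H : Type v} [NormedAddCommGroup H]
    [InnerProductSpace ℂ H] (S : H →L[ℂ] H) {p q : ℝ} (hp : 0 ≤ p) (hq : 0 ≤ q)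
    (hS : ∀ ξ η : H, 0 ≤ p * ‖ξ‖ ^ 2 + 2 * (⟪ξ, S η⟫_ℂ).re + q * ‖η‖ ^ 2) :
    ‖S‖ ^ 2 ≤ p * q := by
  rw [← Real.le_sqrt (norm_nonneg _) (mul_nonneg hp hq)]
  refine S.opNorm_le_bound (Real.sqrt_nonneg _) fun η => ?_
  rcases (norm_nonneg (S η)).eq_or_lt with h0 | h0
  · rw [← h0]
    positivity
  have hd := discrim_le_zero (a := p * ‖S η‖ ^ 2) (b := 2 * ‖S η‖ ^ 2) (c := q * ‖η‖ ^ 2)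
    fun t => by
      have := hS ((t : ℂ) • S η) η
      have hre : (⟪S η, S η⟫_ℂ).re = ‖S η‖ ^ 2 := inner_self_eq_norm_sq (𝕜 := ℂ) _
      rw [inner_smul_left, Complex.conj_ofReal, Complex.re_ofReal_mul, hre, norm_smul,
        Complex.norm_real, mul_pow, Real.norm_eq_abs, sq_abs] at this
      linarith
  rw [discrim] at hd
  have hle : ‖S η‖ ^ 2 ≤ p * q * ‖η‖ ^ 2 := by
    refine le_of_mul_le_mul_left ?_ (pow_pos h0 2)
    linarith
  calc ‖S η‖ ≤ √(p * q * ‖η‖ ^ 2) := Real.le_sqrt_of_sq_le hle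
    _ = √(p * q) * ‖η‖ := by
      rw [Real.sqrt_mul (mul_nonneg hp hq), Real.sqrt_sq (norm_nonneg _)]

/-- Let `A` be a unital C*-algebra and `φ : A → B(H)` a
completely positive completely contractive map.  If
`∑ₖ φ(αₖαₖ*) - ∑ₖ φ(αₖ)φ(αₖ)* ≤ ε·1`, then
`‖∑ₖ φ(αₖβₖ*) - ∑ₖ φ(αₖ)φ(βₖ)*‖² ≤ 2ε‖∑ₖ βₖβₖ*‖`. -/
theorem norm_sq_sum_le_of_cpc
    {A : Type u} [CStarAlgebra A] {H : Type v} [NormedAddCommGroup H]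
    [InnerProductSpace ℂ H] [CompleteSpace H] (φ : A → H →L[ℂ] H)
    (hφ : IsCPCMap φ) {n : ℕ} (hn : 1 ≤ n) (α β : Fin n → A) {ε : ℝ} (hε : 0 ≤ ε)
    (h : (ε • (1 : H →L[ℂ] H) -
        (∑ k, φ (α k * star (α k)) - ∑ k, φ (α k) * star (φ (α k)))).IsPositive) :
    ‖∑ k, φ (α k * star (β k)) - ∑ k, φ (α k) * star (φ (β k))‖ ^ 2
      ≤ 2 * ε * ‖∑ k, β k * star (β k)‖ := by
  simp only [← Finset.sum_sub_distrib] at h ⊢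
  set B := ‖∑ k, β k * star (β k)‖ with hB
  have hα (ξ : H) :
      ∑ k, (⟪ξ, (φ (α k * star (α k)) - φ (α k) * star (φ (α k))) ξ⟫_ℂ).re ≤ ε * ‖ξ‖ ^ 2 := by
    have h1 : 0 ≤ (⟪ξ, _⟫_ℂ).re := h.re_inner_nonneg_right ξ
    have hre : (⟪ξ, ξ⟫_ℂ).re = ‖ξ‖ ^ 2 := inner_self_eq_norm_sq (𝕜 := ℂ) _
    rw [sub_apply, inner_sub_right, sum_apply, inner_sum,
      smul_apply, one_apply_eq_self, inner_smul_right_eq_smul,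
      Complex.sub_re, Complex.re_sum, Complex.smul_re, hre, smul_eq_mul] at h1
    linarith
  have hβ (η : H) :
      ∑ k, (⟪η, (φ (β k * star (β k)) - φ (β k) * star (φ (β k))) η⟫_ℂ).re ≤ B * ‖η‖ ^ 2 := by
    calc _ ≤ ∑ k, (⟪η, φ (β k * star (β k)) η⟫_ℂ).re := by
          refine Finset.sum_le_sum fun k _ => ?_
          rw [sub_apply, inner_sub_right, Complex.sub_re, sub_le_self_iff,
            mul_apply_eq_comp, ← ContinuousLinearMap.adjoint_inner_left,
            ← ContinuousLinearMap.star_eq_adjoint]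
          exact inner_self_nonneg (𝕜 := ℂ)
      _ = (⟪η, φ (∑ k, β k * star (β k)) η⟫_ℂ).re := by
          have := map_sum (AddMonoidHom.mk' φ hφ.map_add) (fun k => β k * star (β k)) Finset.univ
          simp only [AddMonoidHom.mk'_apply] at this
          rw [this, sum_apply, inner_sum, Complex.re_sum]
      _ ≤ ‖η‖ * ‖φ (∑ k, β k * star (β k)) η‖ := re_inner_le_norm (𝕜 := ℂ) _ _
      _ ≤ ‖η‖ * (B * ‖η‖) := by
          gcongr
          exact ContinuousLinearMap.le_of_opNorm_le _ (hφ.contractive _) η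
      _ = B * ‖η‖ ^ 2 := by ring
  have hB0 : 0 ≤ B := norm_nonneg _
  have key := opNorm_sq_le_of_forall_nonneg
    (∑ k, (φ (α k * star (β k)) - φ (α k) * star (φ (β k)))) hε hB0 fun ξ η => by
      have hs := Finset.sum_nonneg fun k (_ : k ∈ Finset.univ) =>
        hφ.schwarz_nonneg (α k) (β k) ξ η
      rw [Finset.sum_add_distrib, Finset.sum_add_distrib, ← Finset.mul_sum] at hs
      rw [sum_apply, inner_sum, Complex.re_sum]
      linarith [hα ξ, hβ η]
  linarith [mul_nonneg hε hB0]

end
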